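/- Let V : ℝⁿ → ℝ be a convex function such that exp(-sV) is integrable for all s in an open interval I ⊂ (0,∞). Then the function s ↦ sⁿ · ∫ exp(-s·V(x)) dx is log-concave on I. -/

import Mathlib

open MeasureTheory
open scoped ENNReal Topology Pointwise

theorem IsCompact.volume_add_volume_le {K L C : Set ℝ} (hK : IsCompact K) (hL : IsCompact L)
    (hK' : K.Nonempty) (hL' : L.Nonempty) (h : ∀ x ∈ K, ∀ y ∈ L, x + y ∈ C) :
    volume K + volume L ≤ volume C := by
  obtain ⟨m, hmL, hm⟩ := hL.exists_isLeast hL'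
  obtain ⟨M, hMK, hM⟩ := hK.exists_isGreatest hK'
  have hinter : volume ((m +ᵥ K) ∩ (M +ᵥ L)) = 0 := by
    refine measure_mono_null (t := {M + m}) ?_ (by simp)
    rintro _ ⟨⟨x, hx, rfl⟩, ⟨y, hy, hxy⟩⟩
    have h1 := hM hx
    have h2 := hm hy
    simp only [vadd_eq_add, Set.mem_singleton_iff] at hxy ⊢
    linarith
  have hmeas : MeasurableSet (M +ᵥ L) := (hL.vadd M).measurableSet
  calc volume K + volume L = volume (m +ᵥ K) + volume (M +ᵥ L) := by simp
    _ = volume ((m +ᵥ K) ∪ (M +ᵥ L)) := by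
      rw [← measure_union_add_inter _ hmeas, hinter, add_zero]
    _ ≤ volume C := by
      refine measure_mono ?_
      rintro _ (⟨x, hx, rfl⟩ | ⟨y, hy, rfl⟩)
      · simpa [add_comm] using h x hx m hmL
      · simpa using h M hMK y hy

/-- The one-dimensional **Brunn–Minkowski inequality**. -/
theorem Real.volume_add_volume_le {A B C : Set ℝ} (hA : MeasurableSet A) (hB : MeasurableSet B)
    (hA' : A.Nonempty) (hB' : B.Nonempty) (h : ∀ x ∈ A, ∀ y ∈ B, x + y ∈ C) :
    volume A + volume B ≤ volume C := by
  obtain ⟨x₀, hx₀⟩ := hA'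
  obtain ⟨y₀, hy₀⟩ := hB'
  rw [hA.measure_eq_iSup_isCompact, hB.measure_eq_iSup_isCompact]
  simp only [iSup_and']
  refine ENNReal.biSup_add_biSup_le' ⟨∅, by simp⟩ ⟨∅, by simp⟩ ?_
  rintro K ⟨hKA, hK⟩ L ⟨hLB, hL⟩
  calc volume K + volume L ≤ volume (insert x₀ K) + volume (insert y₀ L) := by
        gcongr <;> exact Set.subset_insert _ _
    _ ≤ volume C := by
      refine (hK.insert x₀).volume_add_volume_le (hL.insert y₀) ⟨x₀, by simp⟩ ⟨y₀, by simp⟩ ?_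
      exact fun x hx y hy ↦ h x (Set.insert_subset hx₀ hKA hx) y (Set.insert_subset hy₀ hLB hy)

theorem lintegral_eq_lintegral_meas_ofReal_lt {α : Type*} [MeasurableSpace α] (μ : Measure α)
    {f : α → ℝ≥0∞} (hf : Measurable f) (hf' : ∀ x, f x ≠ ∞) :
    ∫⁻ x, f x ∂μ = ∫⁻ t in Set.Ioi (0 : ℝ), μ {x | ENNReal.ofReal t < f x} := by
  have h := lintegral_eq_lintegral_meas_lt μ (f := fun x ↦ (f x).toReal)
    (Filter.Eventually.of_forall fun x ↦ ENNReal.toReal_nonneg) hf.ennreal_toReal.aemeasurable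
  simp only [ENNReal.ofReal_toReal (hf' _)] at h
  rw [h]
  refine setLIntegral_congr_fun measurableSet_Ioi fun t ht ↦ ?_
  simp only [ENNReal.ofReal_lt_iff_lt_toReal (le_of_lt ht) (hf' _)]

theorem ENNReal.geom_mean_le_arith_mean2_weighted {a b : ℝ} (ha : 0 < a) (hb : 0 < b)
    (hab : a + b = 1) (x y : ℝ≥0∞) :
    x ^ a * y ^ b ≤ ENNReal.ofReal a * x + ENNReal.ofReal b * y := by
  rcases eq_or_ne x ∞ with rfl | hx
  · simp [ENNReal.mul_top, ha]
  rcases eq_or_ne y ∞ with rfl | hy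
  · simp [ENNReal.mul_top, hb]
  lift x to NNReal using hx
  lift y to NNReal using hy
  have h := NNReal.geom_mean_le_arith_mean2_weighted a.toNNReal b.toNNReal x y
    (by rw [← Real.toNNReal_add ha.le hb.le, hab, Real.toNNReal_one])
  rw [Real.coe_toNNReal _ ha.le, Real.coe_toNNReal _ hb.le] at h
  rw [← ENNReal.coe_rpow_of_nonneg _ ha.le, ← ENNReal.coe_rpow_of_nonneg _ hb.le]
  simp only [ENNReal.ofReal]
  exact_mod_cast h

section PrekopaLeindler

variable {a b : ℝ}

theorem lintegral_arith_mean_le_of_iSup_eq_one (ha : 0 < a) (hb : 0 < b) (hab : a + b = 1)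
    {f g h : ℝ → ℝ≥0∞} (hf : Measurable f) (hg : Measurable g) (hh : Measurable h)
    (hf1 : ⨆ x, f x = 1) (hg1 : ⨆ x, g x = 1)
    (hfgh : ∀ x y, f x ^ a * g y ^ b ≤ h (a * x + b * y)) :
    ENNReal.ofReal a * (∫⁻ x, f x) + ENNReal.ofReal b * (∫⁻ x, g x) ≤ ∫⁻ x, h x := by
  have hf_le : ∀ x, f x ≤ 1 := fun x ↦ hf1 ▸ le_iSup f x
  have hg_le : ∀ x, g x ≤ 1 := fun x ↦ hg1 ▸ le_iSup g x
  have hscale : ∀ {c : ℝ}, 0 < c → ∀ s : Set ℝ,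
      volume (c • s) = ENNReal.ofReal c * volume s := fun {c} hc s ↦ by
    simp [Measure.addHaar_smul, abs_of_pos hc]
  have key : ∀ t ∈ Set.Ioi (0 : ℝ),
      ENNReal.ofReal a * volume {x | ENNReal.ofReal t < f x}
        + ENNReal.ofReal b * volume {x | ENNReal.ofReal t < g x}
        ≤ volume {x | ENNReal.ofReal t < min (h x) 1} := by
    intro t ht
    rcases le_or_gt 1 t with h1 | h1
    · have h1' : 1 ≤ ENNReal.ofReal t := by simpa using h1
      simp [fun x ↦ ((hf_le x).trans h1').not_gt, fun x ↦ ((hg_le x).trans h1').not_gt]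
    have ht1 : ENNReal.ofReal t < 1 := by simpa using h1
    rw [← hscale ha, ← hscale hb]
    refine Real.volume_add_volume_le ?_ ?_ ?_ ?_ ?_
    · exact (measurableSet_lt measurable_const hf).const_smul₀ a
    · exact (measurableSet_lt measurable_const hg).const_smul₀ b
    · exact (lt_iSup_iff.1 (hf1 ▸ ht1)).elim fun x hx ↦ Set.Nonempty.smul_set ⟨x, hx⟩
    · exact (lt_iSup_iff.1 (hg1 ▸ ht1)).elim fun x hx ↦ Set.Nonempty.smul_set ⟨x, hx⟩
    · rintro _ ⟨x, hx, rfl⟩ _ ⟨y, hy, rfl⟩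
      refine lt_min ?_ ht1
      refine lt_of_lt_of_le ?_ (hfgh x y)
      calc ENNReal.ofReal t = ENNReal.ofReal t ^ a * ENNReal.ofReal t ^ b := by
            rw [← ENNReal.rpow_add _ _ (by simpa using ht) ENNReal.ofReal_ne_top, hab,
              ENNReal.rpow_one]
        _ < f x ^ a * g y ^ b :=
          ENNReal.mul_lt_mul (ENNReal.rpow_lt_rpow hx ha) (ENNReal.rpow_lt_rpow hy hb)
  calc ENNReal.ofReal a * (∫⁻ x, f x) + ENNReal.ofReal b * (∫⁻ x, g x)
      ≤ ∫⁻ x, min (h x) 1 := by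
        rw [lintegral_eq_lintegral_meas_ofReal_lt _ hf fun x ↦ ((hf_le x).trans_lt (by simp)).ne,
          lintegral_eq_lintegral_meas_ofReal_lt _ hg fun x ↦ ((hg_le x).trans_lt (by simp)).ne,
          lintegral_eq_lintegral_meas_ofReal_lt _ (hh.min measurable_const) fun x ↦
            ((min_le_right (h x) 1).trans_lt (by simp)).ne,
          ← lintegral_const_mul' _ _ ENNReal.ofReal_ne_top,
          ← lintegral_const_mul' _ _ ENNReal.ofReal_ne_top]
        exact (le_lintegral_add _ _).trans (setLIntegral_mono' measurableSet_Ioi key)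
    _ ≤ ∫⁻ x, h x := lintegral_mono fun x ↦ min_le_left _ _

theorem prekopaLeindler_real_of_iSup_ne_top (ha : 0 < a) (hb : 0 < b) (hab : a + b = 1)
    {f g h : ℝ → ℝ≥0∞} (hf : Measurable f) (hg : Measurable g) (hh : Measurable h)
    (hf' : ⨆ x, f x ≠ ∞) (hg' : ⨆ x, g x ≠ ∞)
    (hfgh : ∀ x y, f x ^ a * g y ^ b ≤ h (a * x + b * y)) :
    (∫⁻ x, f x) ^ a * (∫⁻ x, g x) ^ b ≤ ∫⁻ x, h x := by
  rcases eq_or_ne (⨆ x, f x) 0 with hf0 | hf0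
  · simp [ENNReal.iSup_eq_zero.1 hf0, ha]
  rcases eq_or_ne (⨆ x, g x) 0 with hg0 | hg0
  · simp [ENNReal.iSup_eq_zero.1 hg0, hb]
  set M := ⨆ x, f x
  set N := ⨆ x, g x
  have hMN0 : M ^ a * N ^ b ≠ 0 := by simp [hf0, hg0, hf', hg']
  have hMNt : M ^ a * N ^ b ≠ ∞ :=
    ENNReal.mul_ne_top (ENNReal.rpow_ne_top_of_nonneg ha.le hf')
      (ENNReal.rpow_ne_top_of_nonneg hb.le hg')
  have hdist : ∀ u v : ℝ≥0∞, (M⁻¹ * u) ^ a * (N⁻¹ * v) ^ b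
      = (M ^ a * N ^ b)⁻¹ * (u ^ a * v ^ b) := fun u v ↦ by
    rw [ENNReal.mul_rpow_of_nonneg _ _ ha.le, ENNReal.mul_rpow_of_nonneg _ _ hb.le,
      ENNReal.inv_rpow, ENNReal.inv_rpow, mul_mul_mul_comm,
      ENNReal.mul_inv (Or.inr (ENNReal.rpow_ne_top_of_nonneg hb.le hg'))
        (Or.inl (ENNReal.rpow_ne_top_of_nonneg ha.le hf'))]
  have := lintegral_arith_mean_le_of_iSup_eq_one ha hb hab (hf.const_mul M⁻¹) (hg.const_mul N⁻¹)
    (hh.const_mul (M ^ a * N ^ b)⁻¹) (by rw [← ENNReal.mul_iSup, ENNReal.inv_mul_cancel hf0 hf'])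
    (by rw [← ENNReal.mul_iSup, ENNReal.inv_mul_cancel hg0 hg'])
    (fun x y ↦ by rw [hdist]; gcongr; exact hfgh x y)
  have := (ENNReal.geom_mean_le_arith_mean2_weighted ha hb hab _ _).trans this
  rw [lintegral_const_mul _ hf, lintegral_const_mul _ hg, lintegral_const_mul _ hh, hdist] at this
  exact (ENNReal.mul_le_mul_iff_right (ENNReal.inv_ne_zero.2 hMNt)
    (ENNReal.inv_ne_top.2 hMN0)).1 this

/-- The one-dimensional **Prékopa–Leindler inequality**. -/
theorem prekopaLeindler_real (ha : 0 < a) (hb : 0 < b) (hab : a + b = 1)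
    {f g h : ℝ → ℝ≥0∞} (hf : Measurable f) (hg : Measurable g) (hh : Measurable h)
    (hfgh : ∀ x y, f x ^ a * g y ^ b ≤ h (a * x + b * y)) :
    (∫⁻ x, f x) ^ a * (∫⁻ x, g x) ^ b ≤ ∫⁻ x, h x := by
  rcases eq_or_ne (∫⁻ x, f x) 0 with hf0 | hf0
  · simp [hf0, ha]
  rcases eq_or_ne (∫⁻ x, g x) 0 with hg0 | hg0
  · simp [hg0, hb]
  have htrunc : ∀ {u : ℝ → ℝ≥0∞}, Measurable u →
      Filter.Tendsto (fun k : ℕ ↦ ∫⁻ x, min (u x) k) Filter.atTop (𝓝 (∫⁻ x, u x)) := by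
    intro u hu
    refine lintegral_tendsto_of_tendsto_of_monotone
      (fun k ↦ (hu.min measurable_const).aemeasurable)
      (Filter.Eventually.of_forall fun x k l hkl ↦ ?_)
      (Filter.Eventually.of_forall fun x ↦ ?_)
    · exact min_le_min_left _ (by exact_mod_cast hkl)
    · simpa using (tendsto_const_nhds (x := u x)).min ENNReal.tendsto_nat_nhds_top
  have hbdd : ∀ (u : ℝ → ℝ≥0∞) (k : ℕ), ⨆ x, min (u x) (k : ℝ≥0∞) ≠ ∞ := fun u k ↦
    ((iSup_le fun x ↦ min_le_right _ _).trans_lt (ENNReal.natCast_lt_top k)).ne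
  refine le_of_tendsto' (ENNReal.Tendsto.mul ((htrunc hf).ennrpow_const a) (Or.inl ?_)
    ((htrunc hg).ennrpow_const b) (Or.inl ?_)) fun k ↦
    prekopaLeindler_real_of_iSup_ne_top ha hb hab (hf.min measurable_const)
      (hg.min measurable_const) hh (hbdd f k) (hbdd g k) fun x y ↦ le_trans ?_ (hfgh x y)
  · simp [hf0, ha.le]
  · simp [hg0, hb.le]
  · gcongr <;> exact min_le_left _ _

/-- The **Prékopa–Leindler inequality** on `Fin n → ℝ`. -/
theorem prekopaLeindler_pi (ha : 0 < a) (hb : 0 < b) (hab : a + b = 1) {n : ℕ}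
    {f g h : (Fin n → ℝ) → ℝ≥0∞} (hf : Measurable f) (hg : Measurable g) (hh : Measurable h)
    (hfgh : ∀ x y, f x ^ a * g y ^ b ≤ h (a • x + b • y)) :
    (∫⁻ x, f x) ^ a * (∫⁻ x, g x) ^ b ≤ ∫⁻ x, h x := by
  induction n with
  | zero =>
    simp only [Measure.volume_pi_eq_dirac (0 : Fin 0 → ℝ), lintegral_dirac]
    exact (hfgh _ _).trans_eq (congrArg h (Subsingleton.elim _ _))
  | succ n ih =>
    let e := (MeasurableEquiv.piFinSuccAbove (fun _ : Fin (n + 1) ↦ ℝ) 0).symm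
    have hfub : ∀ {u : (Fin (n + 1) → ℝ) → ℝ≥0∞}, Measurable u →
        ∫⁻ x, u x = ∫⁻ t, ∫⁻ z, u (e (t, z)) := fun {u} hu ↦ by
      rw [← (volume_preserving_piFinSuccAbove (fun _ : Fin (n + 1) ↦ ℝ) 0).symm.lintegral_comp hu]
      exact lintegral_prod _ (hu.comp e.measurable).aemeasurable
    have he : ∀ t s z w, a • e (t, z) + b • e (s, w) = e (a * t + b * s, a • z + b • w) := by
      intro t s z w
      ext i
      refine Fin.cases ?_ (fun i ↦ ?_) i <;> simp [e, MeasurableEquiv.piFinSuccAbove]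
    rw [hfub hf, hfub hg, hfub hh]
    have hmeas : ∀ {u : (Fin (n + 1) → ℝ) → ℝ≥0∞}, Measurable u →
        Measurable fun p : ℝ × (Fin n → ℝ) ↦ u (e p) := fun hu ↦ hu.comp e.measurable
    refine prekopaLeindler_real ha hb hab (hmeas hf).lintegral_prod_right'
      (hmeas hg).lintegral_prod_right' (hmeas hh).lintegral_prod_right' fun t s ↦ ?_
    refine ih ((hmeas hf).comp measurable_prodMk_left) ((hmeas hg).comp measurable_prodMk_left)
      ((hmeas hh).comp measurable_prodMk_left) fun z w ↦ ?_
    simpa only [he] using hfgh (e (t, z)) (e (s, w))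

/-- The **Prékopa–Leindler inequality** on Euclidean space. -/
theorem prekopaLeindler_euclideanSpace (ha : 0 < a) (hb : 0 < b) (hab : a + b = 1) {n : ℕ}
    {f g h : EuclideanSpace ℝ (Fin n) → ℝ≥0∞} (hf : Measurable f) (hg : Measurable g)
    (hh : Measurable h) (hfgh : ∀ x y, f x ^ a * g y ^ b ≤ h (a • x + b • y)) :
    (∫⁻ x, f x) ^ a * (∫⁻ x, g x) ^ b ≤ ∫⁻ x, h x := by
  have hp := PiLp.volume_preserving_toLp (Fin n)
  rw [← hp.lintegral_comp hf, ← hp.lintegral_comp hg, ← hp.lintegral_comp hh]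
  exact prekopaLeindler_pi ha hb hab (hf.comp hp.measurable) (hg.comp hp.measurable)
    (hh.comp hp.measurable) fun x y ↦ hfgh (WithLp.toLp 2 x) (WithLp.toLp 2 y)

end PrekopaLeindler

theorem stmt2 (n : ℕ) (V : EuclideanSpace ℝ (Fin n) → ℝ)
    (hV : ConvexOn ℝ Set.univ V)
    (I : Set ℝ) (hIopen : IsOpen I) (hIconv : Convex ℝ I) (hIpos : I ⊆ Set.Ioi (0 : ℝ))
    (hInt : ∀ s ∈ I, Integrable (fun x => Real.exp (-(s * V x)))) :
    ConcaveOn ℝ I (fun s => Real.log (s ^ n * ∫ x, Real.exp (-(s * V x)))) := by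
  have hcont : Continuous V := continuousOn_univ.1 (hV.continuousOn isOpen_univ)
  have hmeas : ∀ s : ℝ, Measurable fun x ↦ ENNReal.ofReal (Real.exp (-(s * V (s⁻¹ • x)))) :=
    fun s ↦ by fun_prop
  have hlint : ∀ s ∈ I, ∫⁻ x, ENNReal.ofReal (Real.exp (-(s * V (s⁻¹ • x))))
      = ENNReal.ofReal (s ^ n * ∫ x, Real.exp (-(s * V x))) := by
    intro s hs
    have hs0 : 0 < s := hIpos hs
    rw [← ofReal_integral_eq_lintegral_ofReal ((hInt s hs).comp_smul (inv_ne_zero hs0.ne'))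
      (Filter.Eventually.of_forall fun x ↦ (Real.exp_pos _).le),
      Measure.integral_comp_inv_smul_of_nonneg volume (fun x ↦ Real.exp (-(s * V x))) hs0.le,
      finrank_euclideanSpace_fin, smul_eq_mul]
  have hpos : ∀ s ∈ I, 0 < s ^ n * ∫ x, Real.exp (-(s * V x)) := fun s hs ↦
    mul_pos (pow_pos (hIpos hs) n) (integral_exp_pos (hInt s hs))
  refine concaveOn_iff_forall_pos.2 ⟨hIconv, fun s hs t ht a b ha hb hab ↦ ?_⟩
  have hr := hIconv hs ht ha.le hb.le hab
  have hs0 : 0 < s := hIpos hs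
  have ht0 : 0 < t := hIpos ht
  have hr0 : 0 < a * s + b * t := hIpos hr
  have hPL := prekopaLeindler_euclideanSpace ha hb hab (hmeas s) (hmeas t)
    (hmeas (a • s + b • t)) fun x y ↦ ?_
  · rw [hlint s hs, hlint t ht, hlint _ hr,
      ENNReal.ofReal_rpow_of_pos (hpos s hs), ENNReal.ofReal_rpow_of_pos (hpos t ht),
      ← ENNReal.ofReal_mul (Real.rpow_nonneg (hpos s hs).le a),
      ENNReal.ofReal_le_ofReal_iff (hpos _ hr).le] at hPL
    have hs' := Real.rpow_pos_of_pos (hpos s hs) a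
    have ht' := Real.rpow_pos_of_pos (hpos t ht) b
    have hlog := Real.log_le_log (mul_pos hs' ht') hPL
    rwa [Real.log_mul hs'.ne' ht'.ne', Real.log_rpow (hpos s hs), Real.log_rpow (hpos t ht)]
      at hlog
  · rw [ENNReal.ofReal_rpow_of_pos (Real.exp_pos _), ENNReal.ofReal_rpow_of_pos (Real.exp_pos _),
      ← ENNReal.ofReal_mul (Real.rpow_nonneg (Real.exp_pos _).le a), ← Real.exp_mul,
      ← Real.exp_mul, ← Real.exp_add]
    refine ENNReal.ofReal_le_ofReal (Real.exp_le_exp.2 ?_)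
    simp only [smul_eq_mul]
    have hconv := hV.2 (Set.mem_univ (s⁻¹ • x)) (Set.mem_univ (t⁻¹ • y))
      (show 0 ≤ a * s / (a * s + b * t) by positivity)
      (show 0 ≤ b * t / (a * s + b * t) by positivity) (by field_simp)
    have hpt : (a * s / (a * s + b * t)) • s⁻¹ • x + (b * t / (a * s + b * t)) • t⁻¹ • y
        = (a * s + b * t)⁻¹ • (a • x + b • y) := by
      simp only [smul_smul, smul_add]
      congr 2 <;> field_simp
    rw [hpt] at hconv
    have hmul := mul_le_mul_of_nonneg_left hconv hr0.le
    have hexp : (a * s + b * t) * ((a * s / (a * s + b * t)) • V (s⁻¹ • x)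
        + (b * t / (a * s + b * t)) • V (t⁻¹ • y))
        = a * s * V (s⁻¹ • x) + b * t * V (t⁻¹ • y) := by
      simp only [smul_eq_mul]
      field_simp
    rw [hexp] at hmul
    linarith
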